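/- arXiv:1702.05353 — 3 statements merged into one kernel-verified Lean document; each statement's English description precedes it below -/
import Mathlib

section
/- Let A be a set and let p, j : A³ → A be operations satisfying the identities p(x,y,y) = x, p(x,x,y) = j(x,x,y), j(x,y,y) = y, and j(x,y,x) = x for all x, y in A. Let α, β, γ be congruences with respect to p and j, and let m ≥ 2 be an integer. Then α ∩ (β ∘_{m+2} γ) = (α ∩ (β ∘ γ)) ∘ ((α ∩ β) ∘_m (α ∩ γ)). -/
/-- Relational composition: `a (Comp R S) c` iff there is `b` with `a R b` and `b S c`. -/
def Comp {A : Type*} (R S : A → A → Prop) : A → A → Prop :=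
  fun a c => ∃ b, R a b ∧ S b c

/-- `AltComp R S m` is the alternating composition `R ∘ S ∘ R ∘ ⋯` with exactly `m` factors. -/
def AltComp {A : Type*} : (R S : A → A → Prop) → ℕ → A → A → Prop
  | _, _, 0 => Eq
  | R, _, 1 => R
  | R, S, (n+2) => Comp R (AltComp S R (n+1))

/-- Converse relation. -/
def Conv {A : Type*} (R : A → A → Prop) : A → A → Prop := fun a b => R b a

/-- Intersection of relations. -/
def InterRel {A : Type*} (R S : A → A → Prop) : A → A → Prop := fun a b => R a b ∧ S a b

/-- `RelPow R n` is `R ∘ R ∘ ⋯ ∘ R` with `n` factors. -/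
def RelPow {A : Type*} (R : A → A → Prop) : ℕ → A → A → Prop
  | 0 => Eq
  | 1 => R
  | n+2 => Comp R (RelPow R (n+1))

/-- Compatibility of a relation with a ternary operation. -/
def Compat3 {A : Type*} (f : A → A → A → A) (R : A → A → Prop) : Prop :=
  ∀ a a' b b' c c', R a a' → R b b' → R c c' → R (f a b c) (f a' b' c')

/-- Compatibility of a relation with an `n`-ary operation. -/
def CompatV {A : Type*} {n : ℕ} (f : (Fin n → A) → A) (R : A → A → Prop) : Prop :=
  ∀ a b : Fin n → A, (∀ i, R (a i) (b i)) → R (f a) (f b)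

/-- Composition `S 0 ∘ S 1 ∘ ⋯ ∘ S (n-1)` of a family of `n` relations. -/
def FamComp {A : Type*} : (n : ℕ) → (Fin n → A → A → Prop) → A → A → Prop
  | 0, _ => Eq
  | 1, S => S 0
  | n+2, S => Comp (S 0) (FamComp (n+1) (fun i => S i.succ))

/-- The substitution `x_0, x_0, x_2, x_2, x_4, x_4, …` (arguments identified in
consecutive pairs starting from the first two). -/
def EvenPair {A : Type*} (m : ℕ) (x : Fin (m+2) → A) : Fin (m+2) → A :=
  fun j => x ⟨2 * (j.val / 2), by have := j.isLt; omega⟩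

/-- The substitution `x_0, x_1, x_1, x_3, x_3, …` (arguments identified in
consecutive pairs starting from the second and third). -/
def OddPair {A : Type*} (m : ℕ) (x : Fin (m+2) → A) : Fin (m+2) → A :=
  fun j => x ⟨2 * ((j.val + 1) / 2) - 1, by have := j.isLt; omega⟩

section Helpers

variable {A : Type*}

theorem comp_assoc' (R S T : A → A → Prop) : Comp (Comp R S) T = Comp R (Comp S T) := by
  funext a c
  apply propext
  constructor
  · rintro ⟨b, ⟨d, h1, h2⟩, h3⟩
    exact ⟨d, h1, b, h2, h3⟩
  · rintro ⟨b, h1, d, h2, h3⟩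
    exact ⟨d, ⟨b, h1, h2⟩, h3⟩

theorem alt_succ (R S : A → A → Prop) (n : ℕ) :
    AltComp R S (n + 1) = Comp R (AltComp S R n) := by
  cases n with
  | zero =>
    funext a c
    apply propext
    constructor
    · intro h
      exact ⟨c, h, rfl⟩
    · rintro ⟨b, h, rfl⟩
      exact h
  | succ n => rfl

theorem alt_snoc (k : ℕ) : ∀ R S : A → A → Prop,
    AltComp R S (2 * k + 1) = Comp (AltComp R S (2 * k)) R ∧
    AltComp R S (2 * k + 2) = Comp (AltComp R S (2 * k + 1)) S := by
  induction k with
  | zero =>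
    intro R S
    constructor
    · funext a c
      apply propext
      constructor
      · intro h
        exact ⟨a, rfl, h⟩
      · rintro ⟨b, rfl, h⟩
        exact h
    · rfl
  | succ k ih =>
    have h1 : ∀ R S : A → A → Prop,
        AltComp R S (2 * (k + 1) + 1) = Comp (AltComp R S (2 * (k + 1))) R := by
      intro R S
      show AltComp R S ((2 * k + 2) + 1) = Comp (AltComp R S ((2 * k + 1) + 1)) R
      rw [alt_succ, (ih S R).2, alt_succ R S (2 * k + 1), comp_assoc']
    intro R S
    refine ⟨h1 R S, ?_⟩
    show AltComp R S ((2 * (k + 1) + 1) + 1) = Comp (AltComp R S (2 * (k + 1) + 1)) S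
    rw [alt_succ, h1 S R, alt_succ R S, comp_assoc']

theorem compat_comp {f : A → A → A → A} {R S : A → A → Prop}
    (hR : Compat3 f R) (hS : Compat3 f S) : Compat3 f (Comp R S) := by
  rintro a a' b b' c c' ⟨u, h1, h2⟩ ⟨v, h3, h4⟩ ⟨w, h5, h6⟩
  exact ⟨f u v w, hR _ _ _ _ _ _ h1 h3 h5, hS _ _ _ _ _ _ h2 h4 h6⟩

theorem compat_inter {f : A → A → A → A} {R S : A → A → Prop}
    (hR : Compat3 f R) (hS : Compat3 f S) : Compat3 f (InterRel R S) := by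
  rintro a a' b b' c c' ⟨h1, h2⟩ ⟨h3, h4⟩ ⟨h5, h6⟩
  exact ⟨hR _ _ _ _ _ _ h1 h3 h5, hS _ _ _ _ _ _ h2 h4 h6⟩

theorem compat_alt {f : A → A → A → A} (n : ℕ) : ∀ {R S : A → A → Prop},
    Compat3 f R → Compat3 f S → Compat3 f (AltComp R S n) := by
  induction n with
  | zero =>
    intro R S _ _ a a' b b' c c' h1 h2 h3
    cases h1; cases h2; cases h3
    rfl
  | succ n ih =>
    intro R S hR hS
    rw [alt_succ]
    exact compat_comp hR (ih hS hR)

theorem refl_alt (n : ℕ) : ∀ {R S : A → A → Prop},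
    (∀ x, R x x) → (∀ x, S x x) → ∀ x, AltComp R S n x x := by
  induction n with
  | zero => intro R S _ _ x; rfl
  | succ n ih =>
    intro R S hR hS x
    rw [alt_succ]
    exact ⟨x, hR x, ih hS hR x⟩

/-- Moving the next-to-last-but-one point of a chain into the `α`-class. -/
theorem lemA (p j : A → A → A → A)
    (hp1 : ∀ x y, p x y y = x) (hpj : ∀ x y, p x x y = j x x y)
    (hj1 : ∀ x y, j x y y = y) (hj2 : ∀ x y, j x y x = x)
    (α T S Q : A → A → Prop)
    (hα : Equivalence α) (hαj : Compat3 j α)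
    (hT : Equivalence T) (hTp : Compat3 p T) (hTj : Compat3 j T)
    (hS : Equivalence S) (hSp : Compat3 p S) (hSj : Compat3 j S)
    (hQ : ∀ x, Q x x) (hQj : Compat3 j Q)
    (a y x c : A) (hac : α a c) (hay : Q a y) (hyx : S y x) (hxc : T x c) (k : ℕ) :
    ∀ d, α a d → Q a d → AltComp T S (2 * k + 4) d x →
      ∃ l, α a l ∧ Q a l ∧ ∃ u v, T l u ∧ S u v ∧ T v c := by
  have key : ∀ d k1 k2 k3, α a d → Q a d → T d k1 → S k1 k2 → S k3 x →
      α a (j y c d) ∧ Q a (j y c d) ∧ T (j y c d) (j y x k1) ∧ S (j y x k1) (p x k3 k2) := by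
    intro d k1 k2 k3 h1 h2 h3 h4 h5
    refine ⟨?_, ?_, ?_, ?_⟩
    · have := hαj y y c a d a (hα.refl _) (hα.symm hac) (hα.symm h1)
      rw [hj1] at this
      exact hα.symm this
    · have := hQj a y c c a d hay (hQ _) h2
      rwa [hj2] at this
    · exact hTj _ _ _ _ _ _ (hT.refl _) (hT.symm hxc) h3
    · have e1 : S (j y x k1) (j x x k1) := hSj _ _ _ _ _ _ hyx (hS.refl _) (hS.refl _)
      rw [← hpj] at e1
      exact hS.trans e1 (hSp _ _ _ _ _ _ (hS.refl _) (hS.symm h5) h4)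
  induction k with
  | zero =>
    rintro d h1 h2 ⟨k1, h3, k2, h4, k3, h5, h6⟩
    obtain ⟨g1, g2, g3, g4⟩ := key d k1 k2 k3 h1 h2 h3 h4 h6
    refine ⟨_, g1, g2, _, _, g3, g4, ?_⟩
    have := hTp x x k3 k3 k2 k3 (hT.refl _) (hT.refl _) h5
    rw [hp1] at this
    exact hT.trans this hxc
  | succ k ih =>
    intro d h1 h2 h
    have h' : Comp T (Comp S (Comp T (AltComp S T (2 * k + 3)))) d x := h
    have e : AltComp S T (2 * k + 3) = Comp (Comp (AltComp S T (2 * k + 1)) T) S := by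
      have e1 := (alt_snoc (k + 1) S T).1
      have e2 := (alt_snoc k S T).2
      rw [← e2]
      exact e1
    rw [e] at h'
    obtain ⟨k1, h3, k2, h4, w, h5, k3, ⟨w', h6, h7⟩, h8⟩ := h'
    obtain ⟨g1, g2, g3, g4⟩ := key d k1 k2 k3 h1 h2 h3 h4 h8
    refine ih _ g1 g2 ?_
    show Comp T (Comp S (Comp T (AltComp S T (2 * k + 1)))) _ x
    refine ⟨_, g3, _, g4, p x w' w, hTp _ _ _ _ _ _ (hT.refl _) (hT.symm h7) h5, ?_⟩
    have := compat_alt (2 * k + 1) hSp hTp x x w' w' w w'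
      (refl_alt _ hS.refl hT.refl _) (refl_alt _ hS.refl hT.refl _) h6
    rwa [hp1] at this

/-- The even case. -/
theorem lemEven (p j : A → A → A → A)
    (hp1 : ∀ x y, p x y y = x) (hpj : ∀ x y, p x x y = j x x y)
    (hj1 : ∀ x y, j x y y = y) (hj2 : ∀ x y, j x y x = x)
    (α β γ : A → A → Prop)
    (hα : Equivalence α) (hαp : Compat3 p α) (hαj : Compat3 j α)
    (hβ : Equivalence β) (hβp : Compat3 p β) (hβj : Compat3 j β)
    (hγ : Equivalence γ) (hγp : Compat3 p γ) (hγj : Compat3 j γ) (a : A) (k : ℕ) :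
    ∀ c, α a c → AltComp β γ (2 * k + 2) a c →
      ∃ b, α a b ∧ Comp β γ a b ∧ AltComp (InterRel α β) (InterRel α γ) (2 * k) b c := by
  induction k with
  | zero =>
    intro c h1 h2
    exact ⟨c, h1, h2, rfl⟩
  | succ k ih =>
    intro c hac h
    have h' : AltComp β γ (2 * (k + 1) + 2) a c := h
    rw [(alt_snoc (k + 1) β γ).2, (alt_snoc (k + 1) β γ).1] at h'
    obtain ⟨x, ⟨y, h1, h2⟩, h3⟩ := h'
    have hax : AltComp γ β (2 * k + 4) a x := by
      show AltComp γ β ((2 * (k + 1) + 1) + 1) a x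
      rw [alt_succ]
      refine ⟨a, hγ.refl _, ?_⟩
      rw [(alt_snoc (k + 1) β γ).1]
      exact ⟨y, h1, h2⟩
    obtain ⟨l, hl, hQl, u, v, hlu, huv, hvc⟩ := lemA p j hp1 hpj hj1 hj2 α γ β
      (AltComp β γ (2 * (k + 1))) hα hαj hγ hγp hγj hβ hβp hβj
      (refl_alt _ hβ.refl hγ.refl) (compat_alt _ hβj hγj) a y x c hac h1 h2 h3 k a
      (hα.refl _) (refl_alt _ hβ.refl hγ.refl _) hax
    obtain ⟨N, hN, ⟨n, han, hnN⟩, hNl⟩ := ih l hl hQl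
    have hlc : α l c := hα.trans (hα.symm hl) hac
    have hjl : ∀ z, α l (j l z c) := by
      intro z
      have := hαj l l z z l c (hα.refl _) (hα.refl _) hlc
      rwa [hj2] at this
    have hb : α a (p N l c) := by
      have := hαp N a l a c a (hα.symm hN) (hα.symm hl) (hα.symm hac)
      rw [hp1] at this
      exact hα.symm this
    have hbT : Comp β γ a (p N l c) := by
      refine ⟨p n u v, ?_, hγp _ _ _ _ _ _ hnN (hγ.symm hlu) hvc⟩
      have := hβp a n u u u v han (hβ.refl _) huv
      rwa [hp1] at this
    have hαβr : ∀ x, InterRel α β x x := fun x => ⟨hα.refl _, hβ.refl _⟩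
    have hαγr : ∀ x, InterRel α γ x x := fun x => ⟨hα.refl _, hγ.refl _⟩
    have hG : AltComp (InterRel α β) (InterRel α γ) (2 * k) (p N l c) (j l l c) := by
      have := compat_alt (2 * k) (compat_inter hαp hβp) (compat_inter hαp hγp) N l l l c c
        hNl (refl_alt _ hαβr hαγr _) (refl_alt _ hαβr hαγr _)
      rwa [hpj] at this
    have s1 : InterRel α γ (j l l c) (j l u c) :=
      ⟨hα.trans (hα.symm (hjl l)) (hjl u), hγj _ _ _ _ _ _ (hγ.refl _) hlu (hγ.refl _)⟩
    have s2 : InterRel α β (j l u c) (j l v c) :=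
      ⟨hα.trans (hα.symm (hjl u)) (hjl v), hβj _ _ _ _ _ _ (hβ.refl _) huv (hβ.refl _)⟩
    have s3 : InterRel α γ (j l v c) c := by
      refine ⟨hα.trans (hα.symm (hjl v)) hlc, ?_⟩
      have := hγj l l v c c c (hγ.refl _) hvc (hγ.refl _)
      rwa [hj1] at this
    -- absorb the extra `γ` step
    have fin : ∀ b, AltComp (InterRel α β) (InterRel α γ) (2 * k) b (j l u c) →
        AltComp (InterRel α β) (InterRel α γ) (2 * (k + 1)) b c := by
      intro b hb
      show AltComp (InterRel α β) (InterRel α γ) (2 * k + 2) b c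
      rw [(alt_snoc k _ _).2, (alt_snoc k _ _).1]
      exact ⟨_, ⟨_, hb, s2⟩, s3⟩
    cases k with
    | zero =>
      have hG' : p N l c = j l l c := hG
      obtain ⟨e, he1, he2⟩ := hbT
      refine ⟨j l u c, hα.trans hl (hjl u), ⟨e, he1, ?_⟩, fin _ rfl⟩
      rw [hG'] at he2
      exact hγ.trans he2 s1.2
    | succ k =>
      refine ⟨_, hb, hbT, fin _ ?_⟩
      have hG' : AltComp (InterRel α β) (InterRel α γ) (2 * k + 2) (p N l c) (j l l c) := hG
      show AltComp (InterRel α β) (InterRel α γ) (2 * k + 2) (p N l c) (j l u c)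
      rw [(alt_snoc k _ _).2] at hG' ⊢
      obtain ⟨q, hq1, hq2⟩ := hG'
      exact ⟨q, hq1, hα.trans hq2.1 s1.1, hγ.trans hq2.2 s1.2⟩

/-- Reduction of the odd case to the even one. -/
theorem lemOdd (p j : A → A → A → A)
    (hp1 : ∀ x y, p x y y = x) (hpj : ∀ x y, p x x y = j x x y)
    (hj1 : ∀ x y, j x y y = y) (hj2 : ∀ x y, j x y x = x)
    (α β γ : A → A → Prop)
    (hα : Equivalence α) (hαj : Compat3 j α)
    (hβ : Equivalence β) (hβp : Compat3 p β) (hβj : Compat3 j β)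
    (hγ : Equivalence γ) (hγp : Compat3 p γ) (hγj : Compat3 j γ) (a c : A) (k : ℕ)
    (hac : α a c) (h : AltComp β γ (2 * k + 5) a c) :
    ∃ c', α a c' ∧ β c' c ∧ AltComp β γ (2 * k + 4) a c' := by
  have h' : AltComp β γ (2 * (k + 2) + 1) a c := h
  rw [(alt_snoc (k + 2) β γ).1] at h'
  obtain ⟨x, hax, hxc⟩ := h'
  have h2 : AltComp β γ (2 * (k + 1) + 2) a x := hax
  rw [(alt_snoc (k + 1) β γ).2] at h2
  obtain ⟨y, hay, hyx⟩ := h2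
  obtain ⟨l, hl, hQl, u, v, hlu, huv, hvc⟩ := lemA p j hp1 hpj hj1 hj2 α β γ
    (AltComp β γ (2 * (k + 1) + 1)) hα hαj hβ hβp hβj hγ hγp hγj
    (refl_alt _ hβ.refl hγ.refl) (compat_alt _ hβj hγj) a y x c hac hay hyx hxc k a
    (hα.refl _) (refl_alt _ hβ.refl hγ.refl _) hax
  rw [(alt_snoc (k + 1) β γ).1] at hQl
  obtain ⟨z, haz, hzl⟩ := hQl
  have haz' : AltComp β γ (2 * k + 2) a z := haz
  rw [(alt_snoc k β γ).2] at haz'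
  obtain ⟨t, hat, htz⟩ := haz'
  refine ⟨j v l c, ?_, ?_, ?_⟩
  · have := hαj v v l a c a (hα.refl _) (hα.symm hl) (hα.symm hac)
    rw [hj1] at this
    exact hα.symm this
  · have := hβj v c l l c c hvc (hβ.refl _) (hβ.refl _)
    rwa [hj2] at this
  · show AltComp β γ (2 * (k + 1) + 2) a _
    rw [(alt_snoc (k + 1) β γ).2, (alt_snoc (k + 1) β γ).1]
    show Comp (Comp (AltComp β γ (2 * k + 2)) β) γ a _
    rw [(alt_snoc k β γ).2]
    refine ⟨j u l c, ⟨p z u v, ⟨t, hat, ?_⟩, ?_⟩, hγj _ _ _ _ _ _ huv (hγ.refl _) (hγ.refl _)⟩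
    · have := hγp t z u u u v htz (hγ.refl _) huv
      rwa [hp1] at this
    · have e1 : β (p z u v) (p l l c) := hβp _ _ _ _ _ _ hzl (hβ.symm hlu) hvc
      rw [hpj] at e1
      exact hβ.trans e1 (hβj _ _ _ _ _ _ hlu (hβ.refl _) (hβ.refl _))

theorem alt_le (α : A → A → Prop) (hα : Equivalence α) (n : ℕ) : ∀ (R S : A → A → Prop) (b c : A),
    AltComp (InterRel α R) (InterRel α S) n b c → α b c ∧ AltComp R S n b c := by
  induction n with
  | zero =>
    intro R S b c h
    cases h
    exact ⟨hα.refl _, rfl⟩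
  | succ n ih =>
    intro R S b c h
    rw [alt_succ] at h ⊢
    obtain ⟨d, h1, h2⟩ := h
    obtain ⟨h3, h4⟩ := ih _ _ _ _ h2
    exact ⟨hα.trans h1.1 h3, d, h1.2, h4⟩

end Helpers

theorem stmt6 {A : Type*}
    (p j : A → A → A → A)
    (hp1 : ∀ x y, p x y y = x) (hpj : ∀ x y, p x x y = j x x y)
    (hj1 : ∀ x y, j x y y = y) (hj2 : ∀ x y, j x y x = x)
    (α β γ : A → A → Prop)
    (hα : Equivalence α) (hαp : Compat3 p α) (hαj : Compat3 j α)
    (hβ : Equivalence β) (hβp : Compat3 p β) (hβj : Compat3 j β)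
    (hγ : Equivalence γ) (hγp : Compat3 p γ) (hγj : Compat3 j γ)
    (m : ℕ) (hm : 2 ≤ m) :
    InterRel α (AltComp β γ (m + 2)) =
      Comp (InterRel α (Comp β γ)) (AltComp (InterRel α β) (InterRel α γ) m) := by
  funext a c
  apply propext
  constructor
  · rintro ⟨hac, h⟩
    rcases Nat.even_or_odd' m with ⟨k, hk | hk⟩
    · subst hk
      obtain ⟨b, h1, h2, h3⟩ := lemEven p j hp1 hpj hj1 hj2 α β γ hα hαp hαj hβ hβp hβj
        hγ hγp hγj a k c hac h
      exact ⟨b, ⟨h1, h2⟩, h3⟩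
    · obtain ⟨k, rfl⟩ : ∃ i, k = i + 1 := ⟨k - 1, by omega⟩
      subst hk
      obtain ⟨c', h1, h2, h3⟩ := lemOdd p j hp1 hpj hj1 hj2 α β γ hα hαj hβ hβp hβj
        hγ hγp hγj a c k hac h
      obtain ⟨b, g1, g2, g3⟩ := lemEven p j hp1 hpj hj1 hj2 α β γ hα hαp hαj hβ hβp hβj
        hγ hγp hγj a (k + 1) c' h1 h3
      refine ⟨b, ⟨g1, g2⟩, ?_⟩
      rw [(alt_snoc (k + 1) _ _).1]
      exact ⟨c', g3, hα.trans (hα.symm h1) hac, h2⟩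
  · rintro ⟨b, ⟨h1, d, h2, h3⟩, h4⟩
    obtain ⟨h5, h6⟩ := alt_le α hα m _ _ _ _ h4
    refine ⟨hα.trans h1 h5, ?_⟩
    rw [alt_succ, alt_succ]
    exact ⟨d, h2, b, h3, h6⟩
end

section
/- Let A be a set and let t_0, t_1, t_2, t_3 : A³ → A be operations witnessing 3-distributivity, that is, satisfying for all elements of A: t_0(x,y,z) = x; t_i(x,y,x) = x for 0 ≤ i ≤ 3; t_0(x,x,z) = t_1(x,x,z); t_1(x,z,z) = t_2(x,z,z); t_2(x,x,z) = t_3(x,x,z); t_3(x,y,z) = z. Let α, β, γ be congruences with respect to t_0, t_1, t_2, t_3, and let n ≥ 3 be an integer. Then α ∩ (β ∘_{n+1} γ) ⊆ (α ∩ β) ∘_{n+1} (α ∩ γ). -/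
/-- Adjacency of indices usable at step `t` for the (clamped) chain. -/
def Adj8 (n t i j : ℕ) : Prop :=
  i = j ∨ (n + 1 ≤ i ∧ n + 1 ≤ j) ∨ (j = i + 1 ∧ (j + t) % 2 = 0) ∨ (i = j + 1 ∧ (i + t) % 2 = 0)

theorem altComp_of_path {A : Type*} (m : ℕ) : ∀ (R S : A → A → Prop) (s : ℕ → A),
    (∀ t < m, (t % 2 = 0 → R (s t) (s (t + 1))) ∧ (t % 2 = 1 → S (s t) (s (t + 1)))) →
    AltComp R S m (s 0) (s m) := by
  induction m with
  | zero => intro R S s _; rfl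
  | succ m ih =>
    intro R S s h
    cases m with
    | zero => exact (h 0 (by omega)).1 rfl
    | succ m =>
      refine ⟨s 1, (h 0 (by omega)).1 rfl, ?_⟩
      refine ih S R (fun t => s (t + 1)) ?_
      intro t ht
      have := h (t + 1) (by omega)
      exact ⟨fun h0 => this.2 (by omega), fun h0 => this.1 (by omega)⟩

theorem path_of_altComp {A : Type*} (m : ℕ) : ∀ (R S : A → A → Prop) (a c : A),
    AltComp R S m a c → ∃ s : ℕ → A, s 0 = a ∧ s m = c ∧
    (∀ t < m, (t % 2 = 0 → R (s t) (s (t + 1))) ∧ (t % 2 = 1 → S (s t) (s (t + 1)))) := by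
  induction m with
  | zero => intro R S a c h; exact ⟨fun _ => a, rfl, h, by intro t ht; omega⟩
  | succ m ih =>
    intro R S a c h
    cases m with
    | zero =>
      refine ⟨fun t => if t = 0 then a else c, by simp, by simp, ?_⟩
      intro t ht
      obtain rfl : t = 0 := by omega
      exact ⟨fun _ => h, by omega⟩
    | succ m =>
      obtain ⟨b, hab, hb⟩ := h
      obtain ⟨s, s0, sm, hs⟩ := ih S R b c hb
      refine ⟨fun t => if t = 0 then a else s (t - 1), by simp, by simpa using sm, ?_⟩
      intro t ht
      cases t with
      | zero => exact ⟨fun _ => by simpa [s0] using hab, by omega⟩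
      | succ t =>
        have := hs t (by omega)
        simp only [Nat.add_sub_cancel, Nat.add_eq_zero_iff, one_ne_zero, and_false, if_false]
        exact ⟨fun h0 => this.2 (by omega), fun h0 => this.1 (by omega)⟩

section Core
variable {A : Type*} (p q : A → A → A → A) (E : ℕ → A → A → Prop) (P : A → Prop)
  (n : ℕ) (x : ℕ → A)

/-- The data available for the core argument. -/
structure Core8 : Prop where
  pm : ∀ x y, p x y x = x
  qm : ∀ x y, q x y x = x
  pl : ∀ x z, p x x z = x
  pq : ∀ x z, q x z z = p x z z
  ql : ∀ x z, q x x z = z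
  eq : ∀ t, Equivalence (E t)
  cp : ∀ {t a a' b b' c c'}, E t a a' → E t b b' → E t c c' → E t (p a b c) (p a' b' c')
  cq : ∀ {t a a' b b' c c'}, E t a a' → E t b b' → E t c c' → E t (q a b c) (q a' b' c')
  hx : ∀ t i j, Adj8 n t i j → E t (x i) (x j)
  P0 : P (x 0)
  P1 : P (x (n + 1))
  Pp : ∀ {u v w}, P u → P w → P (p u v w)
  Pq : ∀ {u v w}, P u → P w → P (q u v w)
  Pp' : ∀ {u v w}, P u → P v → P (p u v w)

/-- An initial `P`-path: the conditions on the first coordinate. -/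
def UPath (e : A) : Prop := ∃ u : ℕ → A, (∀ t, P (u t)) ∧ E 1 (x 0) (u 1) ∧
  (∀ t, 1 ≤ t → t < n → E (t + 1) (u t) (u (t + 1))) ∧ E (n + 1) (u n) e

variable {p q E P n x}

theorem core_main (H : Core8 p q E P n x) (k F : ℕ) (hk : 2 ≤ k) (hkn : k ≤ n)
    (hF : F % 2 = 1) (hFk : F ≤ k) (hFn : n + 2 ≤ F + k)
    (hu : UPath E P n x (p (x (n + 1)) (x 0) (x (2 * k - 1 - n)))) :
    ∃ s : ℕ → A, s 0 = x 0 ∧ s (n + 1) = x (n + 1) ∧ (∀ t, P (s t)) ∧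
      ∀ t ≤ n, E (t + 1) (s t) (s (t + 1)) := by
  obtain ⟨u, uP, u1, us, un⟩ := hu
  have rf : ∀ t y, E t y y := fun t y => (H.eq t).refl y
  have sy : ∀ {t y z}, E t y z → E t z y := fun {t _ _} h => (H.eq t).symm h
  have tr : ∀ {t y z w}, E t y z → E t z w → E t y w := fun {t _ _ _} h h' => (H.eq t).trans h h'
  let w : ℕ → A := fun t => p (x (n + 1)) (x 0) (x t)
  let vq : ℕ → A := fun t => q (x (F - 1 + t)) (x (F - t)) (x t)
  let vp : ℕ → A := fun t => p (x (F - 1 + t)) (x (F - t)) (x t)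
  let v1 : ℕ → A := fun t => if 2 * t < F then vq t else vp t
  have wP : ∀ t, P (w t) := fun t => H.Pp' H.P1 H.P0
  have hv1 : E 1 (x 0) (v1 1) := by
    by_cases hc : 2 * 1 < F
    · have : v1 1 = vq 1 := if_pos hc
      rw [this]
      have h : E 1 (q (x F) (x F) (x 0)) (vq 1) := H.cq (H.hx _ _ _ (by unfold Adj8; omega))
        (H.hx _ _ _ (by unfold Adj8; omega)) (H.hx _ _ _ (by unfold Adj8; omega))
      rwa [H.ql] at h
    · have : v1 1 = vp 1 := if_neg hc
      rw [this]
      obtain rfl : F = 1 := by omega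
      have h : E 1 (p (x 0) (x 0) (x 0)) (vp 1) := H.cp (H.hx _ _ _ (by unfold Adj8; omega))
        (H.hx _ _ _ (by unfold Adj8; omega)) (H.hx _ _ _ (by unfold Adj8; omega))
      rwa [H.pl] at h
  have hv : ∀ t, 1 ≤ t → E (t + 1) (v1 t) (v1 (t + 1)) := by
    intro t ht
    by_cases hc : 2 * (t + 1) < F
    · have e1 : v1 (t + 1) = vq (t + 1) := if_pos hc
      have e2 : v1 t = vq t := if_pos (by omega)
      rw [e1, e2]
      exact H.cq (H.hx _ _ _ (by unfold Adj8; omega))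
        (H.hx _ _ _ (by unfold Adj8; omega)) (H.hx _ _ _ (by unfold Adj8; omega))
    · have e1 : v1 (t + 1) = vp (t + 1) := if_neg hc
      by_cases hd : 2 * t < F
      · have e2 : v1 t = vq t := if_pos hd
        rw [e1, e2]
        have h1 : E (t + 1) (vq t) (q (x (F - 1 + t)) (x t) (x t)) := H.cq (rf _ _)
          (H.hx _ _ _ (by unfold Adj8; omega)) (rf _ _)
        rw [H.pq] at h1
        refine tr h1 (H.cp ?_ ?_ ?_) <;> exact H.hx _ _ _ (by unfold Adj8; omega)
      · have e2 : v1 t = vp t := if_neg hd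
        rw [e1, e2]
        exact H.cp (H.hx _ _ _ (by unfold Adj8; omega))
          (H.hx _ _ _ (by unfold Adj8; omega)) (H.hx _ _ _ (by unfold Adj8; omega))
  have hvk : E k (v1 (k - 1)) (w k) := by
    have e2 : v1 (k - 1) = vp (k - 1) := if_neg (by omega)
    rw [e2]
    exact H.cp (H.hx _ _ _ (by unfold Adj8; omega))
      (H.hx _ _ _ (by unfold Adj8; omega)) (H.hx _ _ _ (by unfold Adj8; omega))
  let s : ℕ → A := fun t => if t = 0 then x 0 else if t < k then p (u t) (v1 t) (w k)
    else if t ≤ n then q (u t) (w (2 * k - 1 - t)) (w t) else x (n + 1)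
  have s0 : s 0 = x 0 := if_pos rfl
  have sa : ∀ t, 1 ≤ t → t < k → s t = p (u t) (v1 t) (w k) := by
    intro t h1 h2
    simp only [s, if_neg (show t ≠ 0 by omega), if_pos h2]
  have sb : ∀ t, k ≤ t → t ≤ n → s t = q (u t) (w (2 * k - 1 - t)) (w t) := by
    intro t h1 h2
    simp only [s, if_neg (show t ≠ 0 by omega), if_neg (show ¬ t < k by omega), if_pos h2]
  have sc : s (n + 1) = x (n + 1) := by
    simp only [s, if_neg (show n + 1 ≠ 0 by omega), if_neg (show ¬ n + 1 < k by omega),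
      if_neg (show ¬ n + 1 ≤ n by omega)]
  refine ⟨s, s0, sc, ?_, ?_⟩
  · intro t
    simp only [s]
    split_ifs
    · exact H.P0
    · exact H.Pp (uP _) (wP _)
    · exact H.Pq (uP _) (wP _)
    · exact H.P1
  · intro t ht
    rcases Nat.eq_zero_or_pos t with rfl | hpos
    · rw [s0, sa _ (by omega) (by omega)]
      have h : E 1 (p (x 0) (x 0) (w k)) (p (u 1) (v1 1) (w k)) := H.cp u1 hv1 (rf _ _)
      rwa [H.pl] at h
    · by_cases h1 : t + 1 < k
      · rw [sa _ (by omega) h1, sa _ (by omega) (by omega)]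
        exact H.cp (us t hpos (by omega)) (hv t hpos) (rf _ _)
      · by_cases h2 : t + 1 = k
        · rw [sa _ (by omega) (by omega), sb _ (by omega) (by omega)]
          have e : t = k - 1 := by omega
          have h3 : E (t + 1) (p (u t) (v1 t) (w k)) (p (u t) (w k) (w k)) := by
            refine H.cp (rf _ _) ?_ (rf _ _)
            rw [h2, e]; exact hvk
          rw [← H.pq] at h3
          refine tr h3 (H.cq (us t hpos (by omega)) ?_ ?_)
          · exact H.cp (rf _ _) (rf _ _) (H.hx _ _ _ (by unfold Adj8; omega))
          · rw [h2]; exact rf _ _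
        · by_cases h3 : t = n
          · subst h3
            rw [sb _ (by omega) (by omega), sc]
            have h4 : E (t + 1) (q (u t) (w (2 * k - 1 - t)) (w t))
                (q (w (2 * k - 1 - t)) (w (2 * k - 1 - t)) (p (x (t + 1)) (x 0) (x (t + 1)))) :=
              H.cq un (rf _ _) (H.cp (rf _ _) (rf _ _) (H.hx _ _ _ (by unfold Adj8; omega)))
            rwa [H.ql, H.pm] at h4
          · rw [sb _ (by omega) (by omega), sb _ (by omega) (by omega)]
            refine H.cq (us t hpos (by omega)) (H.cp (rf _ _) (rf _ _) ?_)
              (H.cp (rf _ _) (rf _ _) ?_) <;> exact H.hx _ _ _ (by unfold Adj8; omega)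

/-- `n` even, slow path. -/
theorem upath_even (H : Core8 p q E P n x) (hn : 3 ≤ n) (h2 : n % 2 = 0) :
    UPath E P n x (p (x (n + 1)) (x 0) (x 1)) := by
  have rf : ∀ t y, E t y y := fun t y => (H.eq t).refl y
  refine ⟨fun t => q (x (n + 1)) (x (n + 1 - t)) (x 0), fun t => H.Pq H.P1 H.P0, ?_, ?_, ?_⟩
  · have h : E 1 (q (x (n + 1)) (x (n + 1)) (x 0)) (q (x (n + 1)) (x (n + 1 - 1)) (x 0)) :=
      H.cq (rf _ _) (H.hx _ _ _ (by unfold Adj8; omega)) (rf _ _)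
    rwa [H.ql] at h
  · intro t h1 h3
    exact H.cq (rf _ _) (H.hx _ _ _ (by unfold Adj8; omega)) (rf _ _)
  · have h : E (n + 1) (q (x (n + 1)) (x (n + 1 - n)) (x 0)) (q (x (n + 1)) (x 0) (x 0)) :=
      H.cq (rf _ _) (H.hx _ _ _ (by unfold Adj8; omega)) (rf _ _)
    rw [H.pq] at h
    exact (H.eq _).trans h (H.cp (rf _ _) (rf _ _) (H.hx _ _ _ (by unfold Adj8; omega)))

/-- `n` odd. -/
theorem upath_odd (H : Core8 p q E P n x) (hn : 3 ≤ n) (h2 : n % 2 = 1) :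
    UPath E P n x (p (x (n + 1)) (x 0) (x 2)) := by
  have rf : ∀ t y, E t y y := fun t y => (H.eq t).refl y
  have sy : ∀ {t y z}, E t y z → E t z y := fun {t _ _} h => (H.eq t).symm h
  have tr : ∀ {t y z w}, E t y z → E t z w → E t y w := fun {t _ _ _} h h' => (H.eq t).trans h h'
  let r : ℕ → A := fun t => q (x (n + 1)) (x (n - t)) (x 0)
  have rP : ∀ t, P (r t) := fun t => H.Pq H.P1 H.P0
  have rs : ∀ t, E (t + 1) (r t) (r (t + 1)) := fun t =>
    H.cq (rf _ _) (H.hx _ _ _ (by unfold Adj8; omega)) (rf _ _)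
  let h : A := q (x n) (x (n - 1)) (x 0)
  have hodd : ∀ t, t % 2 = 1 → E t h (x 0) := by
    intro t ht
    have : E t h (q (x n) (x n) (x 0)) :=
      H.cq (rf _ _) (H.hx _ _ _ (by unfold Adj8; omega)) (rf _ _)
    rwa [H.ql] at this
  have hr1 : E 2 h (r 1) := H.cq (H.hx _ _ _ (by unfold Adj8; omega)) (rf _ _) (rf _ _)
  have hr2 : E 2 (r 1) (r 2) := rs 1
  let g : ℕ → A := fun t => if t = 1 then p (x 0) h (r 1) else if t = 2 then q (x 0) h (r 2)
    else r t
  have last : E n (g (n - 1)) (p (x (n + 1)) (x 0) (x 1)) := by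
    have a1 : E n (r (n - 1)) (p (x (n + 1)) (x 0) (x 1)) := by
      have : E n (r (n - 1)) (q (x (n + 1)) (x 0) (x 0)) :=
        H.cq (rf _ _) (H.hx _ _ _ (by unfold Adj8; omega)) (rf _ _)
      rw [H.pq] at this
      exact tr this (H.cp (rf _ _) (rf _ _) (H.hx _ _ _ (by unfold Adj8; omega)))
    by_cases h3 : n = 3
    · subst h3
      have : E 3 (q (x 0) h (r 2)) (q (x 0) (x 0) (r 2)) :=
        H.cq (rf _ _) (hodd 3 rfl) (rf _ _)
      rw [H.ql] at this
      exact tr this a1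
    · have : g (n - 1) = r (n - 1) := by
        simp only [g, if_neg (show n - 1 ≠ 1 by omega), if_neg (show n - 1 ≠ 2 by omega)]
      rw [this]; exact a1
  refine ⟨fun t => if t = n then p (x (n + 1)) (x 0) (x 1) else g t, ?_, ?_, ?_, ?_⟩
  · intro t
    simp only [g]
    split_ifs
    · exact H.Pp' H.P1 H.P0
    · exact H.Pp H.P0 (rP _)
    · exact H.Pq H.P0 (rP _)
    · exact rP _
  · simp only [if_neg (show 1 ≠ n by omega)]
    have : E 1 (p (x 0) (x 0) (r 1)) (p (x 0) h (r 1)) :=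
      H.cp (rf _ _) (sy (hodd 1 rfl)) (rf _ _)
    rwa [H.pl] at this
  · intro t h1 h3
    simp only [if_neg (show t ≠ n by omega)]
    by_cases h4 : t + 1 = n
    · simp only [if_pos h4]
      obtain rfl : t = n - 1 := by omega
      rw [h4]; exact last
    · simp only [if_neg h4]
      rcases (show t = 1 ∨ t = 2 ∨ 3 ≤ t by omega) with rfl | rfl | h5
      · have a1 : E 2 (p (x 0) h (r 1)) (p (x 0) (r 1) (r 1)) := H.cp (rf _ _) hr1 (rf _ _)
        rw [← H.pq] at a1
        exact tr a1 (H.cq (rf _ _) (sy hr1) hr2)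
      · have a1 : E 3 (q (x 0) h (r 2)) (q (x 0) (x 0) (r 3)) :=
          H.cq (rf _ _) (hodd 3 rfl) (rs 2)
        rw [H.ql] at a1
        exact a1
      · simp only [g, if_neg (show t ≠ 1 by omega), if_neg (show t ≠ 2 by omega),
          if_neg (show t + 1 ≠ 1 by omega), if_neg (show t + 1 ≠ 2 by omega)]
        exact rs t
  · simp only [if_true]
    exact H.cp (rf _ _) (rf _ _) (H.hx _ _ _ (by unfold Adj8; omega))

/-- `n` even, fast path. -/
theorem upath_fast (H : Core8 p q E P n x) (hn : 6 ≤ n) (h2 : n % 2 = 0) :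
    UPath E P n x (p (x (n + 1)) (x 0) (x 3)) := by
  have rf : ∀ t y, E t y y := fun t y => (H.eq t).refl y
  have sy : ∀ {t y z}, E t y z → E t z y := fun {t _ _} h => (H.eq t).symm h
  have tr : ∀ {t y z w}, E t y z → E t z w → E t y w := fun {t _ _ _} h h' => (H.eq t).trans h h'
  let r : ℕ → A := fun t => q (x (n + 1)) (x (n - 1 - t)) (x 0)
  have rP : ∀ t, P (r t) := fun t => H.Pq H.P1 H.P0
  have rs : ∀ t, E (t + 1) (r t) (r (t + 1)) := fun t =>
    H.cq (rf _ _) (H.hx _ _ _ (by unfold Adj8; omega)) (rf _ _)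
  let h1 : A := q (x (n - 1)) (x (n - 2)) (x 0)
  let h2 : A := q (x n) (x (n - 3)) (x 0)
  have hodd : ∀ t, t % 2 = 1 → E t h1 (x 0) := by
    intro t ht
    have : E t h1 (q (x (n - 1)) (x (n - 1)) (x 0)) :=
      H.cq (rf _ _) (H.hx _ _ _ (by unfold Adj8; omega)) (rf _ _)
    rwa [H.ql] at this
  have h12 : ∀ t, t % 2 = 0 → E t h1 h2 := fun t ht =>
    H.cq (H.hx _ _ _ (by unfold Adj8; omega)) (H.hx _ _ _ (by unfold Adj8; omega)) (rf _ _)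
  have hr2 : E 3 h2 (r 2) := H.cq (H.hx _ _ _ (by unfold Adj8; omega))
    (H.hx _ _ _ (by unfold Adj8; omega)) (rf _ _)
  let g : ℕ → A := fun t => if t = 1 then p (x 0) h1 (r 1) else if t = 2 then p (x 0) h2 (r 2)
    else if t = 3 then q (x 0) h2 (r 3) else if t = 4 then q (x 0) h1 (r 4) else r t
  have last : E (n - 1) (g (n - 2)) (p (x (n + 1)) (x 0) (x 1)) := by
    have a1 : E (n - 1) (r (n - 2)) (p (x (n + 1)) (x 0) (x 1)) := by
      have : E (n - 1) (r (n - 2)) (q (x (n + 1)) (x 0) (x 0)) :=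
        H.cq (rf _ _) (H.hx _ _ _ (by unfold Adj8; omega)) (rf _ _)
      rw [H.pq] at this
      exact tr this (H.cp (rf _ _) (rf _ _) (H.hx _ _ _ (by unfold Adj8; omega)))
    by_cases h3 : n = 6
    · subst h3
      have : E 5 (q (x 0) h1 (r 4)) (q (x 0) (x 0) (r 4)) :=
        H.cq (rf _ _) (hodd 5 rfl) (rf _ _)
      rw [H.ql] at this
      exact tr this a1
    · have : g (n - 2) = r (n - 2) := by
        simp only [g, if_neg (show n - 2 ≠ 1 by omega), if_neg (show n - 2 ≠ 2 by omega),
          if_neg (show n - 2 ≠ 3 by omega), if_neg (show n - 2 ≠ 4 by omega)]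
      rw [this]; exact a1
  refine ⟨fun t => if t = n then p (x (n + 1)) (x 0) (x 2) else
    if t = n - 1 then p (x (n + 1)) (x 0) (x 1) else g t, ?_, ?_, ?_, ?_⟩
  · intro t
    simp only [g]
    split_ifs
    · exact H.Pp' H.P1 H.P0
    · exact H.Pp' H.P1 H.P0
    · exact H.Pp H.P0 (rP _)
    · exact H.Pp H.P0 (rP _)
    · exact H.Pq H.P0 (rP _)
    · exact H.Pq H.P0 (rP _)
    · exact rP _
  · simp only [if_neg (show 1 ≠ n by omega), if_neg (show 1 ≠ n - 1 by omega)]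
    have : E 1 (p (x 0) (x 0) (r 1)) (p (x 0) h1 (r 1)) :=
      H.cp (rf _ _) (sy (hodd 1 rfl)) (rf _ _)
    rwa [H.pl] at this
  · intro t ht h3
    simp only [if_neg (show t ≠ n by omega)]
    by_cases h4 : t + 1 = n
    · simp only [if_pos h4, if_pos (show t = n - 1 by omega)]
      exact H.cp (rf _ _) (rf _ _) (H.hx _ _ _ (by unfold Adj8; omega))
    · simp only [if_neg h4, if_neg (show t ≠ n - 1 by omega)]
      by_cases h6 : t + 1 = n - 1
      · simp only [if_pos h6]
        obtain rfl : t = n - 2 := by omega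
        rw [h6]; exact last
      · simp only [if_neg h6]
        rcases (show t = 1 ∨ t = 2 ∨ t = 3 ∨ t = 4 ∨ 5 ≤ t by omega) with
          rfl | rfl | rfl | rfl | h5
        · exact H.cp (rf _ _) (h12 2 rfl) (rs 1)
        · have a1 : E 3 (p (x 0) h2 (r 2)) (p (x 0) (r 2) (r 2)) := H.cp (rf _ _) hr2 (rf _ _)
          rw [← H.pq] at a1
          exact tr a1 (H.cq (rf _ _) (sy hr2) (rs 2))
        · exact H.cq (rf _ _) (sy (h12 4 rfl)) (rs 3)
        · have a1 : E 5 (q (x 0) h1 (r 4)) (q (x 0) (x 0) (r 5)) :=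
            H.cq (rf _ _) (hodd 5 rfl) (rs 4)
          rw [H.ql] at a1
          exact a1
        · simp only [g, if_neg (show t ≠ 1 by omega), if_neg (show t ≠ 2 by omega),
            if_neg (show t ≠ 3 by omega), if_neg (show t ≠ 4 by omega),
            if_neg (show t + 1 ≠ 1 by omega), if_neg (show t + 1 ≠ 2 by omega),
            if_neg (show t + 1 ≠ 3 by omega), if_neg (show t + 1 ≠ 4 by omega)]
          exact rs t
  · simp only [if_true]
    exact H.cp (rf _ _) (rf _ _) (H.hx _ _ _ (by unfold Adj8; omega))

theorem core_final (H : Core8 p q E P n x) (hn : 3 ≤ n) :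
    ∃ s : ℕ → A, s 0 = x 0 ∧ s (n + 1) = x (n + 1) ∧ (∀ t, P (s t)) ∧
      ∀ t ≤ n, E (t + 1) (s t) (s (t + 1)) := by
  rcases (show n % 2 = 1 ∨ n % 4 = 0 ∨ n % 4 = 2 by omega) with h | h | h
  · obtain ⟨k, hk⟩ : ∃ k, 2 * k = n + 3 := ⟨(n + 3) / 2, by omega⟩
    have e : 2 * k - 1 - n = 2 := by omega
    refine core_main H k (2 * ((k - 1) / 2) + 1) (by omega) (by omega) (by omega) (by omega)
      (by omega) ?_
    rw [e]; exact upath_odd H hn h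
  · obtain ⟨k, hk⟩ : ∃ k, 2 * k = n + 2 := ⟨(n + 2) / 2, by omega⟩
    have e : 2 * k - 1 - n = 1 := by omega
    refine core_main H k (2 * ((k - 1) / 2) + 1) (by omega) (by omega) (by omega) (by omega)
      (by omega) ?_
    rw [e]; exact upath_even H hn (by omega)
  · obtain ⟨k, hk⟩ : ∃ k, 2 * k = n + 4 := ⟨(n + 4) / 2, by omega⟩
    have e : 2 * k - 1 - n = 3 := by omega
    refine core_main H k (2 * ((k - 1) / 2) + 1) (by omega) (by omega) (by omega) (by omega)
      (by omega) ?_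
    rw [e]; exact upath_fast H (by omega) (by omega)

end Core

theorem stmt8 {A : Type*}
    (t0 t1 t2 t3 : A → A → A → A)
    (h0 : ∀ x y z, t0 x y z = x)
    (hmid0 : ∀ x y, t0 x y x = x) (hmid1 : ∀ x y, t1 x y x = x)
    (hmid2 : ∀ x y, t2 x y x = x) (hmid3 : ∀ x y, t3 x y x = x)
    (h01 : ∀ x z, t0 x x z = t1 x x z)
    (h12 : ∀ x z, t1 x z z = t2 x z z)
    (h23 : ∀ x z, t2 x x z = t3 x x z)
    (h3 : ∀ x y z, t3 x y z = z)
    (α β γ : A → A → Prop)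
    (hα : Equivalence α)
    (hα0 : Compat3 t0 α) (hα1 : Compat3 t1 α) (hα2 : Compat3 t2 α) (hα3 : Compat3 t3 α)
    (hβ : Equivalence β)
    (hβ0 : Compat3 t0 β) (hβ1 : Compat3 t1 β) (hβ2 : Compat3 t2 β) (hβ3 : Compat3 t3 β)
    (hγ : Equivalence γ)
    (hγ0 : Compat3 t0 γ) (hγ1 : Compat3 t1 γ) (hγ2 : Compat3 t2 γ) (hγ3 : Compat3 t3 γ)
    (n : ℕ) (hn : 3 ≤ n) :
    ∀ a c, InterRel α (AltComp β γ (n + 1)) a c →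
      AltComp (InterRel α β) (InterRel α γ) (n + 1) a c := by
  rintro a c ⟨hac, hch⟩
  obtain ⟨y, y0, yn, hy⟩ := path_of_altComp _ _ _ _ _ hch
  let x : ℕ → A := fun i => if i ≤ n + 1 then y i else c
  have x0 : x 0 = a := by simp [x, y0]
  have xn : ∀ i, n + 1 ≤ i → x i = c := by
    intro i hi
    by_cases h : i = n + 1
    · subst h; simp [x, yn]
    · simp only [x, if_neg (show ¬ i ≤ n + 1 by omega)]
  let E : ℕ → A → A → Prop := fun t => if t % 2 = 1 then β else γ
  have Eq' : ∀ t, Equivalence (E t) := by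
    intro t; by_cases h : t % 2 = 1
    · simpa only [E, if_pos h] using hβ
    · simpa only [E, if_neg h] using hγ
  have Ec1 : ∀ t, Compat3 t1 (E t) := by
    intro t; by_cases h : t % 2 = 1
    · simpa only [E, if_pos h] using hβ1
    · simpa only [E, if_neg h] using hγ1
  have Ec2 : ∀ t, Compat3 t2 (E t) := by
    intro t; by_cases h : t % 2 = 1
    · simpa only [E, if_pos h] using hβ2
    · simpa only [E, if_neg h] using hγ2
  have xs : ∀ t i, (i + 1 + t) % 2 = 0 → E t (x i) (x (i + 1)) := by
    intro t i hi
    by_cases hin : i < n + 1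
    · have e1 : x i = y i := if_pos (by omega)
      have e2 : x (i + 1) = y (i + 1) := if_pos (by omega)
      rw [e1, e2]
      by_cases h : t % 2 = 1
      · simpa only [E, if_pos h] using (hy i hin).1 (by omega)
      · simpa only [E, if_neg h] using (hy i hin).2 (by omega)
    · rw [xn i (by omega), xn (i + 1) (by omega)]
      exact (Eq' t).refl _
  have H : Core8 t1 t2 E (α a) n x :=
    { pm := hmid1
      qm := hmid2
      pl := fun x z => by rw [← h01, h0]
      pq := fun x z => (h12 x z).symm
      ql := fun x z => by rw [h23, h3]
      eq := Eq'
      cp := fun h h' h'' => Ec1 _ _ _ _ _ _ _ h h' h''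
      cq := fun h h' h'' => Ec2 _ _ _ _ _ _ _ h h' h''
      hx := by
        rintro t i j (rfl | ⟨h, h'⟩ | ⟨rfl, h⟩ | ⟨rfl, h⟩)
        · exact (Eq' t).refl _
        · rw [xn i h, xn j h']; exact (Eq' t).refl _
        · exact xs t i h
        · exact (Eq' t).symm (xs t j h)
      P0 := by rw [x0]; exact hα.refl a
      P1 := by rw [xn _ le_rfl]; exact hac
      Pp := by
        intro u v w hu hw
        have := hα1 a u v v a w hu (hα.refl v) hw
        rwa [hmid1] at this
      Pq := by
        intro u v w hu hw
        have := hα2 a u v v a w hu (hα.refl v) hw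
        rwa [hmid2] at this
      Pp' := by
        intro u v w hu hv
        have := hα1 a u a v w w hu hv (hα.refl w)
        rwa [← h01, h0] at this }
  obtain ⟨s, s0, sn, sP, ss⟩ := core_final H hn
  have hs0 : s 0 = a := s0.trans x0
  have hsn : s (n + 1) = c := sn.trans (xn _ le_rfl)
  rw [← hs0, ← hsn]
  refine altComp_of_path _ _ _ s ?_
  intro t ht
  have hαs : α (s t) (s (t + 1)) := hα.trans (hα.symm (sP t)) (sP (t + 1))
  have hE := ss t (by omega)
  refine ⟨fun h => ⟨hαs, ?_⟩, fun h => ⟨hαs, ?_⟩⟩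
  · simpa only [E, if_pos (show (t + 1) % 2 = 1 by omega)] using hE
  · simpa only [E, if_neg (show ¬ (t + 1) % 2 = 1 by omega)] using hE
end

section
/- Let A be a set, k ≥ 1 an integer, and let p, j_1, …, j_{k+1} : A³ → A be Gumm operations, that is, satisfying for all elements of A: p(x,z,z) = x; p(x,x,z) = j_1(x,x,z); j_i(x,y,x) = x for 1 ≤ i ≤ k+1; j_i(x,z,z) = j_{i+1}(x,z,z) for odd i with 1 ≤ i ≤ k; j_i(x,x,z) = j_{i+1}(x,x,z) for even i with 1 ≤ i ≤ k; j_{k+1}(x,y,z) = z. Let α be a tolerance with respect to these operations and let β, γ be congruences with respect to these operations. Then α ∩ (β ∘ γ ∘ β) ⊆ (α ∩ (γ ∘ β)) ∘ ((α ∩ γ) ∘_{2k} (α ∩ β)). -/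
theorem altComp_chain {A : Type*} (R S : A → A → Prop) (s t : ℕ → A) (n : ℕ) :
    ∀ i, (∀ m, i ≤ m → m < i + (n+1) → R (s m) (t m) ∧ S (t m) (s (m+1))) →
      AltComp R S (2 * (n+1)) (s i) (s (i + (n+1))) := by
  induction n with
  | zero =>
    intro i h
    have := h i le_rfl (by omega)
    exact ⟨t i, this.1, this.2⟩
  | succ n ih =>
    intro i h
    have h0 := h i le_rfl (by omega)
    have h1 := ih (i+1) (fun m hm hm' => h m (by omega) (by omega))
    refine ⟨t i, h0.1, s (i+1), h0.2, ?_⟩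
    have e : i + 1 + (n + 1) = i + (n + 1 + 1) := by omega
    rw [e] at h1
    exact h1

theorem stmt13 {A : Type*}
    (k : ℕ) (hk : 1 ≤ k)
    (p : A → A → A → A) (j : Fin (k+1) → A → A → A → A)
    (hp : ∀ x z, p x z z = x)
    (hpj : ∀ x z, p x x z = j 0 x x z)
    (hjmid : ∀ (i : Fin (k+1)) x y, j i x y x = x)
    (hjodd : ∀ (i : ℕ) (h1 : 1 ≤ i) (h2 : i ≤ k), i % 2 = 1 →
      ∀ x z, j ⟨i-1, by omega⟩ x z z = j ⟨i, by omega⟩ x z z)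
    (hjeven : ∀ (i : ℕ) (h1 : 1 ≤ i) (h2 : i ≤ k), i % 2 = 0 →
      ∀ x z, j ⟨i-1, by omega⟩ x x z = j ⟨i, by omega⟩ x x z)
    (hjlast : ∀ x y z, j (Fin.last k) x y z = z)
    (α : A → A → Prop)
    (hαrefl : ∀ a, α a a) (hαsymm : ∀ a b, α a b → α b a)
    (hαp : Compat3 p α) (hαj : ∀ i, Compat3 (j i) α)
    (β γ : A → A → Prop)
    (hβ : Equivalence β) (hβp : Compat3 p β) (hβj : ∀ i, Compat3 (j i) β)
    (hγ : Equivalence γ) (hγp : Compat3 p γ) (hγj : ∀ i, Compat3 (j i) γ) :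
    ∀ a c, InterRel α (Comp β (Comp γ β)) a c →
      Comp (InterRel α (Comp γ β)) (AltComp (InterRel α γ) (InterRel α β) (2 * k)) a c := by
  rintro a c ⟨hac, b, hab, d, hbd, hdc⟩
  have key : ∀ i u x, α u a → α u c → α u (j i a x c) := by
    intro i u x h1 h2
    have := hαj i u a x x u c h1 (hαrefl x) h2
    rwa [hjmid] at this
  have hca := hαsymm _ _ hac
  have toa : ∀ i x, α (j i a x c) a := fun i x =>
    hαsymm _ _ (key i a x (hαrefl a) hac)
  have toc : ∀ i x, α (j i a x c) c := fun i x =>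
    hαsymm _ _ (key i c x hca (hαrefl c))
  have cross : ∀ i i' x y, α (j i a x c) (j i' a y c) := fun i i' x y =>
    key i' _ y (toa i x) (toc i x)
  have ra := hβ.refl a
  have rc := hβ.refl c
  let f : ℕ → Fin (k+1) := fun m => ⟨min m k, by omega⟩
  have hfe : ∀ m, m < k → m % 2 = 0 → ∀ x z, j (f m) x z z = j (f (m+1)) x z z := by
    intro m hm he x z
    have := hjodd (m+1) (by omega) (by omega) (by omega) x z
    have e1 : f m = ⟨m + 1 - 1, by omega⟩ := Fin.ext (by simp [f]; omega)
    have e2 : f (m+1) = ⟨m + 1, by omega⟩ := Fin.ext (by simp [f]; omega)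
    rw [e1, e2]; exact this
  have hfo : ∀ m, m < k → m % 2 = 1 → ∀ x z, j (f m) x x z = j (f (m+1)) x x z := by
    intro m hm he x z
    have := hjeven (m+1) (by omega) (by omega) (by omega) x z
    have e1 : f m = ⟨m + 1 - 1, by omega⟩ := Fin.ext (by simp [f]; omega)
    have e2 : f (m+1) = ⟨m + 1, by omega⟩ := Fin.ext (by simp [f]; omega)
    rw [e1, e2]; exact this
  let s : ℕ → A := fun m => j (f m) a (if m % 2 = 0 then b else d) c
  let t : ℕ → A := fun m => j (f m) a (if m % 2 = 0 then d else b) c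
  have hstep : ∀ m, 0 ≤ m → m < 0 + ((k-1)+1) →
      InterRel α γ (s m) (t m) ∧ InterRel α β (t m) (s (m+1)) := by
    intro m _ hm
    refine ⟨⟨cross _ _ _ _, ?_⟩, ⟨cross _ _ _ _, ?_⟩⟩
    · refine hγj _ _ _ _ _ _ _ (hγ.refl a) ?_ (hγ.refl c)
      split_ifs
      · exact hbd
      · exact hγ.symm hbd
    · rcases Nat.mod_two_eq_zero_or_one m with he | he
      · have he' : (m+1) % 2 ≠ 0 := by omega
        simp only [s, t, if_pos he, if_neg he']
        have h1 := hβj (f m) a a d c c c ra hdc rc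
        rw [hfe m (by omega) he] at h1
        exact hβ.trans h1 (hβj _ _ _ _ _ _ _ ra (hβ.symm hdc) rc)
      · have he' : (m+1) % 2 = 0 := by omega
        have he2 : m % 2 ≠ 0 := by omega
        simp only [s, t, if_neg he2, if_pos he']
        have h1 := hβj (f m) a a b a c c ra (hβ.symm hab) rc
        rw [hfo m (by omega) he] at h1
        exact hβ.trans h1 (hβj _ _ _ _ _ _ _ ra hab rc)
  have hchain := altComp_chain (InterRel α γ) (InterRel α β) s t (k-1) 0 hstep
  have ek : k - 1 + 1 = k := by omega
  have hs : s (0 + k) = c := by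
    have e : f (0 + k) = Fin.last k := Fin.ext (by simp [f])
    simp only [s]
    rw [e, hjlast]
  rw [ek, hs] at hchain
  have e0 : f 0 = 0 := Fin.ext (by simp [f])
  refine ⟨s 0, ⟨hαsymm _ _ (toa _ _), p a b d, ?_, ?_⟩, hchain⟩
  · have := hγp a a b b b d (hγ.refl a) (hγ.refl b) hbd
    rwa [hp] at this
  · have h1 := hβp a a b a d c ra (hβ.symm hab) hdc
    rw [hpj] at h1
    have h2 := hβj 0 a a a b c c ra hab rc
    simp only [s, e0]
    exact hβ.trans h1 h2
end
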